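/- (Theorem C.) For j ≥ 1 let c_j = Σ_{i=1}^{j} i·G(i), and for k ≥ 1 let Q_k : ℝ → ℝ be Q_k(s) = Π_{j=1}^{k} (s − c_j), so that the components of the vector field F_{Q_k} are polynomials of degree 1 + 2k. Let N k be the number (Set.ncard) of distinct sets S ⊆ ℝ × ℝ that are ranges of nonconstant periodic solutions of x' = F_{Q_k}(x). Then there is no computable function f : ℕ → ℕ that is a sharp upper bound for this family, i.e. no computable f such that: (1) for all n and all k ≥ 1 with 2k + 1 ≤ n, N k ≤ f(n); and (2) for every n ≥ 3 there exists k ≥ 1 with 2k + 1 ≤ n and N k = f(n). -/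

import Mathlib

/-- `g k i = 1` if machine `k` halts on input `k` within `i` steps, else `0`. -/
noncomputable def haltStep (k i : ℕ) : ℝ :=
  if (Nat.Partrec.Code.evaln i (Denumerable.ofNat Nat.Partrec.Code k) k).isSome then 1 else 0

/-- `G k = ∑_{i=1}^∞ g k i / 2^(i+1)`. -/
noncomputable def haltSum (k : ℕ) : ℝ :=
  ∑' i : ℕ, haltStep k (i + 1) / 2 ^ (i + 2)

/-- The planar vector field `F_P(x₁,x₂) = (−x₂ + x₁·P(x₁²+x₂²), x₁ + x₂·P(x₁²+x₂²))`. -/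
def planarField (P : ℝ → ℝ) (x : ℝ × ℝ) : ℝ × ℝ :=
  (-x.2 + x.1 * P (x.1 ^ 2 + x.2 ^ 2), x.1 + x.2 * P (x.1 ^ 2 + x.2 ^ 2))

/-- `S` is a periodic orbit of `x' = F_P(x)`: the range of a nonconstant periodic solution. -/
def IsPeriodicOrbit (P : ℝ → ℝ) (S : Set (ℝ × ℝ)) : Prop :=
  ∃ x : ℝ → ℝ × ℝ, (∀ t : ℝ, HasDerivAt x (planarField P (x t)) t) ∧
    (∃ T : ℝ, 0 < T ∧ ∀ t : ℝ, x (t + T) = x t) ∧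
    (¬ ∃ p : ℝ × ℝ, ∀ t : ℝ, x t = p) ∧
    S = Set.range x

/-- `c j = ∑_{i=1}^j i·G(i)`. -/
noncomputable def cSum (j : ℕ) : ℝ := ∑ i ∈ Finset.Icc 1 j, (i : ℝ) * haltSum i

/-- `Q_k(s) = ∏_{j=1}^k (s − c_j)`. -/
noncomputable def QPoly (k : ℕ) (s : ℝ) : ℝ := ∏ j ∈ Finset.Icc 1 k, (s - cSum j)

/-- The number of periodic orbits of the system `x' = F_{Q_k}(x)`. -/
noncomputable def numOrbitsQ (k : ℕ) : ℕ :=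
  {S : Set (ℝ × ℝ) | IsPeriodicOrbit (QPoly k) S}.ncard

open Nat.Partrec (Code)

/-! ### Periodic orbits of the planar field -/

/-- The circle of squared radius `c` centred at the origin. -/
def circleSq (c : ℝ) : Set (ℝ × ℝ) := {p | p.1 ^ 2 + p.2 ^ 2 = c}

/-- A periodic solution of a continuous scalar autonomous equation is stationary. -/
theorem periodic_scalar_solution_stationary {g v : ℝ → ℝ} (hg : Continuous g)
    (hv : ∀ t, HasDerivAt v (g (v t)) t) {T : ℝ} (hT : 0 < T) (hper : ∀ t, v (t + T) = v t)
    (t : ℝ) : g (v t) = 0 := by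
  have hΦ : ∀ y, HasDerivAt (fun y => ∫ s in (0 : ℝ)..y, g s) (g y) y := fun y =>
    intervalIntegral.integral_hasDerivAt_right (hg.intervalIntegrable _ _)
      (hg.stronglyMeasurableAtFilter _ _) hg.continuousAt
  have hw : ∀ t, HasDerivAt (fun t => ∫ s in (0 : ℝ)..(v t), g s) (g (v t) * g (v t)) t :=
    fun t => (hΦ (v t)).comp t (hv t)
  set w : ℝ → ℝ := fun t => ∫ s in (0 : ℝ)..(v t), g s with hw_def
  have hmono : Monotone w := by
    apply monotone_of_deriv_nonneg (fun t => (hw t).differentiableAt)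
    intro t
    rw [(hw t).deriv]
    exact mul_self_nonneg _
  have hloc : ∀ s ∈ Set.Ioo t (t + T), w s = w t := by
    intro s hs
    have h1 := hmono hs.1.le
    have h2 := hmono hs.2.le
    have h3 : w (t + T) = w t := by simp only [hw_def, hper]
    linarith
  have hmid : t + T / 2 ∈ Set.Ioo t (t + T) := ⟨by linarith, by linarith⟩
  have hpos : ∀ s ∈ Set.Ioo t (t + T), g (v s) = 0 := by
    intro s hs
    have hev : w =ᶠ[nhds s] fun _ => w t := by
      filter_upwards [isOpen_Ioo.mem_nhds hs] with r hr using hloc r hr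
    exact mul_self_eq_zero.mp
      ((hw s).unique ((hasDerivAt_const s (w t)).congr_of_eventuallyEq hev))
  have hvc : Continuous v := continuous_iff_continuousAt.mpr fun s => (hv s).continuousAt
  have hcl : IsClosed {s | g (v s) = 0} := isClosed_eq (hg.comp hvc) continuous_const
  have hsub : closure (Set.Ioo t (t + T)) ⊆ {s | g (v s) = 0} := hcl.closure_subset_iff.mpr hpos
  rw [closure_Ioo (by linarith)] at hsub
  exact hsub ⟨le_refl _, by linarith⟩

/-- Rotating a point of squared norm `c > 0` sweeps out the whole circle. -/
theorem range_rotation {a b c : ℝ} (hc : 0 < c) (hab : a ^ 2 + b ^ 2 = c) :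
    Set.range (fun t : ℝ => (a * Real.cos t - b * Real.sin t, a * Real.sin t + b * Real.cos t)) =
      circleSq c := by
  ext ⟨p, q⟩
  simp only [Set.mem_range, circleSq, Set.mem_ofPred_eq, Prod.mk.injEq]
  constructor
  · rintro ⟨t, rfl, rfl⟩
    linear_combination hab + (a ^ 2 + b ^ 2) * Real.sin_sq_add_cos_sq t
  · intro hpq
    set z : ℂ := ⟨(a * p + b * q) / c, (a * q - b * p) / c⟩ with hz
    have hn : ‖z‖ = 1 := by
      rw [← sq_eq_sq₀ (norm_nonneg _) zero_le_one, ← Complex.normSq_eq_norm_sq,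
        Complex.normSq_apply]
      simp only [hz]
      field_simp
      linear_combination (p ^ 2 + q ^ 2) * hab + c * hpq
    have hz0 : z ≠ 0 := by
      intro h
      simp [h] at hn
    refine ⟨z.arg, ?_, ?_⟩
    · rw [Complex.cos_arg hz0, Complex.sin_arg, hn]
      simp only [hz]
      field_simp
      linear_combination p * hab
    · rw [Complex.cos_arg hz0, Complex.sin_arg, hn]
      simp only [hz]
      field_simp
      linear_combination q * hab

/-- Solutions of the harmonic oscillator are rotations of their initial value. -/
theorem eq_rotation_of_hasDerivAt {x y : ℝ → ℝ} (hx : ∀ t, HasDerivAt x (-y t) t)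
    (hy : ∀ t, HasDerivAt y (x t) t) (t : ℝ) :
    x t = x 0 * Real.cos t - y 0 * Real.sin t ∧ y t = x 0 * Real.sin t + y 0 * Real.cos t := by
  have hu : ∀ t, HasDerivAt (fun t => x t * Real.cos t + y t * Real.sin t) 0 t := fun t => by
    refine (((hx t).mul (Real.hasDerivAt_cos t)).add ((hy t).mul (Real.hasDerivAt_sin t))).congr_deriv ?_
    ring
  have hv : ∀ t, HasDerivAt (fun t => y t * Real.cos t - x t * Real.sin t) 0 t := fun t => by
    refine (((hy t).mul (Real.hasDerivAt_cos t)).sub ((hx t).mul (Real.hasDerivAt_sin t))).congr_deriv ?_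
    ring
  have h1 := is_const_of_deriv_eq_zero (fun t => (hu t).differentiableAt)
    (fun t => (hu t).deriv) t 0
  have h2 := is_const_of_deriv_eq_zero (fun t => (hv t).differentiableAt)
    (fun t => (hv t).deriv) t 0
  simp only [Real.cos_zero, Real.sin_zero, mul_one, mul_zero, add_zero, sub_zero] at h1 h2
  have h3 := Real.sin_sq_add_cos_sq t
  constructor
  · linear_combination Real.cos t * h1 - Real.sin t * h2 - x t * h3
  · linear_combination Real.sin t * h1 + Real.cos t * h2 - y t * h3

theorem isPeriodicOrbit_iff {P : ℝ → ℝ} (hP : Continuous P) (S : Set (ℝ × ℝ)) :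
    IsPeriodicOrbit P S ↔ ∃ c : ℝ, (0 < c ∧ P c = 0) ∧ circleSq c = S := by
  constructor
  · rintro ⟨x, hx, ⟨T, hT, hper⟩, hne, rfl⟩
    have h1 : ∀ t, HasDerivAt (fun t => (x t).1) (planarField P (x t)).1 t := fun t => (hx t).fst
    have h2 : ∀ t, HasDerivAt (fun t => (x t).2) (planarField P (x t)).2 t := fun t => (hx t).snd
    have hr : ∀ t, HasDerivAt (fun t => (x t).1 ^ 2 + (x t).2 ^ 2)
        ((fun r => 2 * r * P r) ((x t).1 ^ 2 + (x t).2 ^ 2)) t := fun t => by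
      refine (((h1 t).pow 2).add ((h2 t).pow 2)).congr_deriv ?_
      simp only [planarField]
      push_cast
      ring
    have hst := periodic_scalar_solution_stationary (g := fun r => 2 * r * P r) (by fun_prop) hr hT
      (fun t => by simp only [hper])
    have hconst : ∀ t, (x t).1 ^ 2 + (x t).2 ^ 2 = (x 0).1 ^ 2 + (x 0).2 ^ 2 := fun t =>
      is_const_of_deriv_eq_zero (fun t => (hr t).differentiableAt)
        (fun t => (hr t).deriv.trans (hst t)) t 0
    have hc : 0 < (x 0).1 ^ 2 + (x 0).2 ^ 2 := by
      refine lt_of_le_of_ne (by positivity) fun h0 => hne ⟨0, fun t => ?_⟩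
      have ht := hconst t
      rw [← h0] at ht
      have ha : (x t).1 = 0 := by nlinarith [sq_nonneg (x t).1, sq_nonneg (x t).2]
      have hb : (x t).2 = 0 := by nlinarith [sq_nonneg (x t).1, sq_nonneg (x t).2]
      exact Prod.ext ha hb
    have hP0 : P ((x 0).1 ^ 2 + (x 0).2 ^ 2) = 0 :=
      (mul_eq_zero.mp (hst 0)).resolve_left (by positivity)
    refine ⟨_, ⟨hc, hP0⟩, ?_⟩
    have hrot := eq_rotation_of_hasDerivAt (x := fun t => (x t).1) (y := fun t => (x t).2)
      (fun t => by simpa [planarField, hconst t, hP0] using h1 t)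
      (fun t => by simpa [planarField, hconst t, hP0] using h2 t)
    rw [← range_rotation hc rfl]
    congr 1
    funext t
    exact (Prod.ext (hrot t).1 (hrot t).2).symm
  · rintro ⟨c, ⟨hc, hP0⟩, rfl⟩
    have hs : √c ^ 2 = c := Real.sq_sqrt hc.le
    have hs0 : 0 < √c := Real.sqrt_pos.mpr hc
    refine ⟨fun t => (√c * Real.cos t - 0 * Real.sin t, √c * Real.sin t + 0 * Real.cos t),
      fun t => ?_, ⟨2 * Real.pi, by positivity, fun t => by simp⟩, ?_,
      (range_rotation hc (by simpa using hs)).symm⟩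
    · have hn : (√c * Real.cos t) ^ 2 + (√c * Real.sin t) ^ 2 = c := by
        linear_combination hs + √c ^ 2 * Real.sin_sq_add_cos_sq t
      simp only [planarField, zero_mul, sub_zero, add_zero, hn, hP0, mul_zero]
      have := ((Real.hasDerivAt_cos t).const_mul (√c)).prodMk
        ((Real.hasDerivAt_sin t).const_mul (√c))
      simpa using this
    · rintro ⟨p, hp⟩
      have h := (hp 0).trans (hp Real.pi).symm
      simp only [Prod.mk.injEq, Real.cos_zero, Real.cos_pi] at h
      simp only [Real.sin_zero, Real.sin_pi] at h
      linarith [h.1]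

theorem injOn_circleSq : Set.InjOn circleSq (Set.Ioi 0) := by
  intro c hc d _ h
  have hc' : (√c, (0 : ℝ)) ∈ circleSq c := by
    simp [circleSq, Real.sq_sqrt (le_of_lt (Set.mem_Ioi.mp hc))]
  rw [h] at hc'
  simpa [circleSq, Real.sq_sqrt (le_of_lt (Set.mem_Ioi.mp hc))] using hc'

/-- The positive roots of `Q_k`. -/
noncomputable def posRoots (k : ℕ) : Finset ℝ := {c ∈ (Finset.Icc 1 k).image cSum | 0 < c}

theorem numOrbitsQ_eq_card (k : ℕ) : numOrbitsQ k = (posRoots k).card := by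
  have hcont : Continuous (QPoly k) := by
    unfold QPoly
    fun_prop
  have hset : {S | IsPeriodicOrbit (QPoly k) S} = circleSq '' (posRoots k : Set ℝ) := by
    ext S
    rw [Set.mem_ofPred_eq, isPeriodicOrbit_iff hcont, Set.mem_image]
    refine exists_congr fun c => and_congr_left' ?_
    simp only [posRoots, QPoly, Finset.prod_eq_zero_iff, sub_eq_zero, Finset.coe_filter,
      Finset.mem_image, Set.mem_ofPred_eq]
    rw [and_comm]
    simp only [eq_comm]
  rw [numOrbitsQ, hset, Set.InjOn.ncard_image, Set.ncard_coe_finset]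
  exact injOn_circleSq.mono fun c hc => (Finset.mem_filter.mp hc).2

/-! ### The coefficients and the halting set -/

/-- Machine `k` halts on input `k`. -/
def SelfHalts (k : ℕ) : Prop := ((Denumerable.ofNat Code k).eval k).Dom

theorem haltStep_nonneg (k i : ℕ) : 0 ≤ haltStep k i := by
  unfold haltStep
  split_ifs <;> norm_num

theorem summable_haltSum (k : ℕ) : Summable fun i : ℕ => haltStep k (i + 1) / 2 ^ (i + 2) := by
  refine Summable.of_nonneg_of_le (fun i => div_nonneg (haltStep_nonneg _ _) (by positivity))
    (fun i => ?_) summable_geometric_two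
  have h1 : haltStep k (i + 1) ≤ 1 := by
    unfold haltStep
    split_ifs <;> norm_num
  rw [one_div_pow]
  have h2 : (2 : ℝ) ^ i ≤ 2 ^ (i + 2) := pow_le_pow_right₀ (by norm_num) (by omega)
  gcongr

theorem haltSum_nonneg (k : ℕ) : 0 ≤ haltSum k :=
  tsum_nonneg fun i => div_nonneg (haltStep_nonneg _ _) (by positivity)

theorem haltSum_pos {k : ℕ} (h : SelfHalts k) : 0 < haltSum k := by
  obtain ⟨a, ha⟩ := Part.dom_iff_mem.mp h
  obtain ⟨i, hi⟩ := Nat.Partrec.Code.evaln_complete.mp ha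
  have hi' := Nat.Partrec.Code.evaln_mono (Nat.le_succ i) hi
  refine (summable_haltSum k).tsum_pos
    (fun i => div_nonneg (haltStep_nonneg _ _) (by positivity)) i ?_
  rw [haltStep, if_pos (Option.isSome_iff_exists.mpr ⟨a, hi'⟩)]
  positivity

theorem haltSum_eq_zero {k : ℕ} (h : ¬ SelfHalts k) : haltSum k = 0 := by
  have h0 : ∀ i, haltStep k i = 0 := fun i => by
    refine if_neg fun hi => h ?_
    obtain ⟨a, ha⟩ := Option.isSome_iff_exists.mp hi
    exact Part.dom_iff_mem.mpr ⟨a, Nat.Partrec.Code.evaln_sound ha⟩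
  simp [haltSum, h0]

theorem cSum_succ (k : ℕ) : cSum (k + 1) = cSum k + ((k + 1 : ℕ) : ℝ) * haltSum (k + 1) :=
  Finset.sum_Icc_succ_top (by omega) _

theorem cSum_monotone : Monotone cSum := monotone_nat_of_le_succ fun k => by
  rw [cSum_succ]
  have := mul_nonneg (Nat.cast_nonneg (α := ℝ) (k + 1)) (haltSum_nonneg (k + 1))
  linarith

theorem cSum_zero : cSum 0 = 0 := by simp [cSum]

open Classical in
theorem numOrbitsQ_succ (k : ℕ) :
    numOrbitsQ (k + 1) = numOrbitsQ k + if SelfHalts (k + 1) then 1 else 0 := by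
  simp only [numOrbitsQ_eq_card]
  have himg : (Finset.Icc 1 (k + 1)).image cSum =
      insert (cSum (k + 1)) ((Finset.Icc 1 k).image cSum) := by
    rw [← Finset.insert_Icc_right_eq_Icc_add_one (by omega), Finset.image_insert]
  split_ifs with h
  · have hlt : cSum k < cSum (k + 1) := by
      rw [cSum_succ]
      have := mul_pos (Nat.cast_pos (α := ℝ).mpr k.succ_pos) (haltSum_pos h)
      linarith
    have hpos : 0 < cSum (k + 1) := by
      have := cSum_monotone k.zero_le
      rw [cSum_zero] at this
      linarith
    rw [posRoots, himg, Finset.filter_insert, if_pos hpos, Finset.card_insert_of_notMem, posRoots]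
    intro hmem
    obtain ⟨j, hj, hje⟩ := Finset.mem_image.mp (Finset.mem_filter.mp hmem).1
    have := cSum_monotone (Finset.mem_Icc.mp hj).2
    linarith
  · have heq : cSum (k + 1) = cSum k := by rw [cSum_succ, haltSum_eq_zero h, mul_zero, add_zero]
    rw [add_zero, posRoots, himg, Finset.filter_insert, heq]
    rcases Nat.eq_zero_or_pos k with rfl | hk
    · rw [cSum_zero, if_neg (lt_irrefl 0), posRoots]
    · split_ifs with hp
      · rw [Finset.insert_eq_of_mem, posRoots]
        exact Finset.mem_filter.mpr
          ⟨Finset.mem_image_of_mem _ (Finset.mem_Icc.mpr ⟨hk, le_rfl⟩), hp⟩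
      · rw [posRoots]

theorem numOrbitsQ_zero : numOrbitsQ 0 = 0 := by simp [numOrbitsQ_eq_card, posRoots]

theorem numOrbitsQ_monotone : Monotone numOrbitsQ := monotone_nat_of_le_succ fun k => by
  classical
  rw [numOrbitsQ_succ]
  exact Nat.le_add_right _ _

/-- The diagonal halting set has no computable indicator function. -/
theorem not_computable_selfHalts {b : ℕ → ℕ} (hb : Computable b) :
    ¬ ∀ k, b k = 0 ↔ ¬ SelfHalts k := by
  intro h
  have hp : Partrec fun n : ℕ =>
      Nat.rfind (fun _ => decide (b n = 0) : ℕ →. Bool) := by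
    refine Partrec.rfind (p := fun n _ => Part.some (decide (b n = 0)))
      (Computable.partrec (f := fun q : ℕ × ℕ => decide (b q.1 = 0)) ?_)
    exact (PrimrecPred.decide (Primrec.eq.comp Primrec.id (Primrec.const 0))).to_comp.comp
      (hb.comp Computable.fst)
  obtain ⟨c, hc⟩ := Nat.Partrec.Code.exists_code.mp (Partrec.nat_iff.mp hp)
  have hdom : SelfHalts (Encodable.encode c) ↔ b (Encodable.encode c) = 0 := by
    rw [SelfHalts, Denumerable.ofNat_encode, hc]
    refine Nat.rfind_dom.trans ⟨?_, fun h0 => ⟨0, by simp [h0], by simp⟩⟩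
    rintro ⟨_, hm, _⟩
    simpa using hm
  have := h (Encodable.encode c)
  tauto

theorem stmt7 :
    ¬ ∃ f : ℕ → ℕ, Computable f ∧
      (∀ n : ℕ, ∀ k : ℕ, 1 ≤ k → 2 * k + 1 ≤ n → numOrbitsQ k ≤ f n) ∧
      (∀ n : ℕ, 3 ≤ n → ∃ k : ℕ, 1 ≤ k ∧ 2 * k + 1 ≤ n ∧ numOrbitsQ k = f n) := by
  rintro ⟨f, hf, hub, hsharp⟩
  have hN : ∀ m, numOrbitsQ (m + 1) = f (2 * m + 3) := by
    intro m
    obtain ⟨k, hk, hkn, he⟩ := hsharp (2 * m + 3) (by omega)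
    exact le_antisymm (hub _ _ (by omega) (by omega))
      (he ▸ numOrbitsQ_monotone (by omega))
  have haff : ∀ a b : ℕ, Primrec fun m : ℕ => a * m + b := fun a b =>
    Primrec.nat_add.comp (Primrec.nat_mul.comp (Primrec.const a) Primrec.id) (Primrec.const b)
  have hcomp : Computable numOrbitsQ := by
    refine (Computable.nat_casesOn (f := fun n : ℕ => n) (g := fun _ => 0)
      (h := fun _ m => f (2 * m + 3)) Computable.id (Computable.const 0)
      ((hf.comp (haff 2 3).to_comp).comp Computable.snd)).of_eq fun n => ?_
    cases n with
    | zero => exact numOrbitsQ_zero.symm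
    | succ m => exact (hN m).symm
  have hb : Computable fun n : ℕ => (Nat.casesOn n 1
      fun m => numOrbitsQ (m + 1) - numOrbitsQ m : ℕ) :=
    Computable.nat_casesOn (h := fun _ m => numOrbitsQ (m + 1) - numOrbitsQ m)
      Computable.id (Computable.const 1)
      (Primrec.nat_sub.to_comp.comp
        ((hcomp.comp Computable.succ).comp Computable.snd) (hcomp.comp Computable.snd))
  refine not_computable_selfHalts hb fun k => ?_
  cases k with
  | zero =>
    have h0 : Denumerable.ofNat Code 0 = Code.zero :=
      (Denumerable.ofNat_encode Code.zero).symm ▸ rfl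
    simp [SelfHalts, h0, Code.eval]
    trivial
  | succ m =>
    classical
    simp only [numOrbitsQ_succ]
    split_ifs with h <;> simp [h]
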